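/- arXiv:2604.21219 — 6 statements merged into one kernel-verified Lean document; each statement's English description precedes it below -/
import Mathlib

section
/- Fix θ′ ∈ (0, π) and φ′ ∈ ℝ. Let D be the open set of (θ, φ) with θ ∈ (0, π), sin(φ−φ′) ≠ 0, X₁(θ,φ) := cos θ cot(φ−φ′) − cot θ′ sin θ csc(φ−φ′) ≠ 0, and X₂(θ,φ) := cos θ′ cot(φ−φ′) − cot θ sin θ′ csc(φ−φ′) ≠ 0. Define h(θ,φ) = arctan(1/X₁(θ,φ)) + arctan(1/X₂(θ,φ)). Then at every point of D the function h satisfies the first-order partial differential equation (−sin θ cos θ′ + cos θ sin θ′ cos(φ−φ′)) · ∂h/∂θ − csc θ · sin θ′ sin(φ−φ′) · ∂h/∂φ = −cot θ · sin θ′ sin(φ−φ′). -/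
/-- The derivative of `arctan (1 / f)` at a point where `f` takes the nonzero value `N / M` and has
the derivative of a quotient `N / M`. -/
theorem hasDerivAt_arctan_one_div {f : ℝ → ℝ} {f' x N M N' M' : ℝ} (hf : HasDerivAt f f' x)
    (hM : M ≠ 0) (hfx : f x = N / M) (hx : f x ≠ 0) (hf' : f' = (N' * M - N * M') / M ^ 2) :
    HasDerivAt (fun t => Real.arctan (1 / f t)) ((M' * N - M * N') / (N ^ 2 + M ^ 2)) x := by
  have hN : N ≠ 0 := by
    rintro rfl
    simp [hfx] at hx
  have hD : N ^ 2 + M ^ 2 ≠ 0 := by positivity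
  have h := (hf.fun_inv hx).arctan
  simp only [one_div]
  convert h using 1
  rw [hfx, hf']
  field_simp
  ring

/-- With `X₁ = cos θ cot(φ−φ′) − cot θ′ sin θ csc(φ−φ′)` and
`X₂ = cos θ′ cot(φ−φ′) − cot θ sin θ′ csc(φ−φ′)`, the function
`h(θ,φ) = arctan(1/X₁) + arctan(1/X₂)` satisfies, at every point of the open set `D`
(where `θ ∈ (0,π)`, `sin(φ−φ′) ≠ 0`, `X₁ ≠ 0`, `X₂ ≠ 0`), the transport PDE
`(−sin θ cos θ′ + cos θ sin θ′ cos(φ−φ′)) ∂h/∂θ − csc θ sin θ′ sin(φ−φ′) ∂h/∂φ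
  = −cot θ sin θ′ sin(φ−φ′)`. -/
theorem stmt4 (θ' φ' : ℝ) (hθ'0 : 0 < θ') (hθ'π : θ' < Real.pi)
    (X₁ X₂ h : ℝ → ℝ → ℝ)
    (hX₁ : X₁ = fun t p =>
      Real.cos t * (Real.cos (p - φ') / Real.sin (p - φ')) -
        (Real.cos θ' / Real.sin θ') * Real.sin t * (1 / Real.sin (p - φ')))
    (hX₂ : X₂ = fun t p =>
      Real.cos θ' * (Real.cos (p - φ') / Real.sin (p - φ')) -
        (Real.cos t / Real.sin t) * Real.sin θ' * (1 / Real.sin (p - φ')))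
    (hh : h = fun t p => Real.arctan (1 / X₁ t p) + Real.arctan (1 / X₂ t p))
    (θ φ : ℝ) (hθ0 : 0 < θ) (hθπ : θ < Real.pi)
    (hs : Real.sin (φ - φ') ≠ 0) (h1 : X₁ θ φ ≠ 0) (h2 : X₂ θ φ ≠ 0) :
    (-Real.sin θ * Real.cos θ' + Real.cos θ * Real.sin θ' * Real.cos (φ - φ')) *
        deriv (fun t => h t φ) θ -
      (1 / Real.sin θ) * Real.sin θ' * Real.sin (φ - φ') * deriv (fun p => h θ p) φ =
      -(Real.cos θ / Real.sin θ) * Real.sin θ' * Real.sin (φ - φ') := by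
  subst hX₁ hX₂ hh
  have hS : Real.sin θ' ≠ 0 := (Real.sin_pos_of_pos_of_lt_pi hθ'0 hθ'π).ne'
  have hs' : Real.sin θ ≠ 0 := (Real.sin_pos_of_pos_of_lt_pi hθ0 hθπ).ne'
  have hsin : HasDerivAt (fun p => Real.sin (p - φ')) (Real.cos (φ - φ')) φ := by
    simpa using ((hasDerivAt_id φ).sub_const φ').sin
  have hcos : HasDerivAt (fun p => Real.cos (p - φ')) (-Real.sin (φ - φ')) φ := by
    simpa using ((hasDerivAt_id φ).sub_const φ').cos
  have e0 := Real.sin_sq_add_cos_sq θ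
  have e1 := Real.sin_sq_add_cos_sq θ'
  have e2 := Real.sin_sq_add_cos_sq (φ - φ')
  have dθ₁ := (((Real.hasDerivAt_cos θ).mul_const
    (Real.cos (φ - φ') / Real.sin (φ - φ'))).sub
    (((Real.hasDerivAt_sin θ).const_mul (Real.cos θ' / Real.sin θ')).mul_const
      (1 / Real.sin (φ - φ'))))
  have dθ₂ := ((((Real.hasDerivAt_cos θ).div (Real.hasDerivAt_sin θ) hs').mul_const
    (Real.sin θ')).mul_const (1 / Real.sin (φ - φ'))).const_sub
      (Real.cos θ' * (Real.cos (φ - φ') / Real.sin (φ - φ')))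
  have dφ₁ := ((hcos.div hsin hs).const_mul (Real.cos θ)).sub
    (((hasDerivAt_const φ (1 : ℝ)).div hsin hs).const_mul
      (Real.cos θ' / Real.sin θ' * Real.sin θ))
  have dφ₂ := ((hcos.div hsin hs).const_mul (Real.cos θ')).sub
    (((hasDerivAt_const φ (1 : ℝ)).div hsin hs).const_mul
      (Real.cos θ / Real.sin θ * Real.sin θ'))
  have aθ₁ := hasDerivAt_arctan_one_div dθ₁
    (N := Real.cos θ * Real.cos (φ - φ') * Real.sin θ' - Real.cos θ' * Real.sin θ)
    (M := Real.sin θ' * Real.sin (φ - φ'))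
    (N' := -Real.sin θ * Real.cos (φ - φ') * Real.sin θ' - Real.cos θ' * Real.cos θ) (M' := 0)
    (mul_ne_zero hS hs) (by simp only [Pi.sub_apply]; field_simp) h1 (by field_simp; ring)
  have aθ₂ := hasDerivAt_arctan_one_div dθ₂
    (N := Real.cos θ' * Real.cos (φ - φ') * Real.sin θ - Real.cos θ * Real.sin θ')
    (M := Real.sin θ * Real.sin (φ - φ'))
    (N' := Real.cos θ' * Real.cos (φ - φ') * Real.cos θ + Real.sin θ * Real.sin θ')
    (M' := Real.cos θ * Real.sin (φ - φ'))
    (mul_ne_zero hs' hs) (by simp only [Pi.div_apply]; field_simp) h2 (by field_simp; ring)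
  have aφ₁ := hasDerivAt_arctan_one_div dφ₁
    (N := Real.cos θ * Real.cos (φ - φ') * Real.sin θ' - Real.cos θ' * Real.sin θ)
    (M := Real.sin θ' * Real.sin (φ - φ'))
    (N' := -Real.cos θ * Real.sin (φ - φ') * Real.sin θ')
    (M' := Real.sin θ' * Real.cos (φ - φ'))
    (mul_ne_zero hS hs) (by simp only [Pi.sub_apply, Pi.div_apply]; field_simp) h1
    (by field_simp; ring)
  have aφ₂ := hasDerivAt_arctan_one_div dφ₂
    (N := Real.cos θ' * Real.cos (φ - φ') * Real.sin θ - Real.cos θ * Real.sin θ')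
    (M := Real.sin θ * Real.sin (φ - φ'))
    (N' := -Real.cos θ' * Real.sin (φ - φ') * Real.sin θ)
    (M' := Real.sin θ * Real.cos (φ - φ'))
    (mul_ne_zero hs' hs) (by simp only [Pi.sub_apply, Pi.div_apply]; field_simp) h2
    (by field_simp; ring)
  have hθ := (aθ₁.add aθ₂).deriv
  have hφ := (aφ₁.add aφ₂).deriv
  refine (congrArg₂ (fun a b =>
    (-Real.sin θ * Real.cos θ' + Real.cos θ * Real.sin θ' * Real.cos (φ - φ')) * a -
      (1 / Real.sin θ) * Real.sin θ' * Real.sin (φ - φ') * b) hθ hφ).trans ?_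
  clear hθ hφ aθ₁ aθ₂ aφ₁ aφ₂ dθ₁ dθ₂ dφ₁ dφ₂ hsin hcos h1 h2
  generalize Real.sin θ = s at *
  generalize Real.cos θ = c at *
  generalize Real.sin θ' = S at *
  generalize Real.cos θ' = C at *
  generalize Real.sin (φ - φ') = m at *
  generalize Real.cos (φ - φ') = k at *
  obtain ⟨g, hg⟩ : ∃ g, g = c * C + s * S * k := ⟨_, rfl⟩
  have hD₁ : (c * k * S - C * s) ^ 2 + (S * m) ^ 2 = 1 - g ^ 2 := by
    subst hg; grind
  have hD₂ : (C * k * s - c * S) ^ 2 + (s * m) ^ 2 = 1 - g ^ 2 := by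
    subst hg; grind
  have hD : 1 - g ^ 2 ≠ 0 := by
    rw [← hD₁]; positivity
  rw [hD₁, hD₂]
  have n1 : (0 * (c * k * S - C * s) - S * m * (-s * k * S - C * c)) = S * m * g := by
    subst hg; ring
  have n2 : (c * m * (C * k * s - c * S) - s * m * (C * k * c + s * S)) = -(m * S) := by
    linear_combination (-m * S) * e0
  have n3 : (S * k * (c * k * S - C * s) - S * m * (-c * m * S)) =
      -(S * (C * k * s - c * S)) := by
    linear_combination S ^ 2 * c * e2
  have n4 : (s * k * (C * k * s - c * S) - s * m * (-C * m * s)) =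
      -(s * (c * k * S - C * s)) := by
    linear_combination s ^ 2 * C * e2
  have key : s * (c * k * S - C * s) * g + S * (C * k * s - c * S) = -c * (1 - g ^ 2) := by
    subst hg; grind
  rw [n1, n2, n3, n4]
  field_simp
  linear_combination key
end

section
/- Let M > 0 and r_m > 2M. Set E² = (1 − 2M/r_m)/r_m² and b = (r_m/2)·(−1 + √((r_m + 6M)/(r_m − 2M))). Then for every real r the polynomial identity E² r⁴ − r² + 2Mr = E² · r · (r − r_m) · (r − b) · (r + r_m + b) holds. In particular, the radial potential R(E, r) = E² r⁴ − r² f(r), with f(r) = 1 − 2M/r, factors with roots 0, r_m, b, and −(r_m + b), and 0 < b. -/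
/-- For `M > 0`, `r_m > 2M`, with `E² = (1 − 2M/r_m)/r_m²` and
`b = (r_m/2)(−1 + √((r_m+6M)/(r_m−2M)))`, the radial potential
`R(E,r) = E²r⁴ − r² + 2Mr` factors as `E² r (r − r_m)(r − b)(r + r_m + b)` for every
real `r`; moreover `0 < b`. -/
theorem stmt9 (M rm : ℝ) (hM : 0 < M) (hrm : 2 * M < rm) :
    let E2 : ℝ := (1 - 2 * M / rm) / rm ^ 2
    let b : ℝ := rm / 2 * (-1 + Real.sqrt ((rm + 6 * M) / (rm - 2 * M)))
    (∀ r : ℝ, E2 * r ^ 4 - r ^ 2 + 2 * M * r =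
      E2 * r * (r - rm) * (r - b) * (r + rm + b)) ∧ 0 < b := by
  intro E2 b
  have hrm0 : 0 < rm := by linarith
  have hd : 0 < rm - 2 * M := by linarith
  have hd_ne : rm - 2 * M ≠ 0 := hd.ne'
  have hs : Real.sqrt ((rm + 6 * M) / (rm - 2 * M)) ^ 2 = (rm + 6 * M) / (rm - 2 * M) :=
    Real.sq_sqrt (by positivity)
  have hb : b * (rm + b) = 2 * M * rm ^ 2 / (rm - 2 * M) := by
    have : b * (rm + b) =
        rm ^ 2 / 4 * (Real.sqrt ((rm + 6 * M) / (rm - 2 * M)) ^ 2 - 1) := by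
      simp only [b]
      ring
    rw [this, hs, div_sub_one hd_ne]
    ring
  have hE : E2 = (rm - 2 * M) / rm ^ 3 := by
    simp only [E2]
    field_simp
  have hlin : E2 * (b * (rm + b)) * rm = 2 * M := by
    rw [hb, hE]
    field_simp
  have hquad : E2 * rm ^ 2 + E2 * (b * (rm + b)) = 1 := by
    rw [hb, hE]
    field_simp
    ring
  refine ⟨fun r => by linear_combination r ^ 2 * hquad - r * hlin, ?_⟩
  have h_one : 1 < Real.sqrt ((rm + 6 * M) / (rm - 2 * M)) := by
    rw [Real.lt_sqrt zero_le_one, one_pow, one_lt_div hd]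
    linarith
  exact mul_pos (by positivity) (by linarith)
end

section
/- Let 0 < b < x < x₀ be real numbers. Then ∫_x^{x₀} ( r(r−x)(r−b)(r+x+b) )^{−1/2} dr = (2/√(x(x+2b))) · ∫_0^{ψ₀} (1 − p sin²ψ)^{−1/2} dψ, where p = b(2x+b)/(x(x+2b)) ∈ (0,1) and ψ₀ = arcsin √( ((x+2b)/(2x+b)) · ((x₀−x)/(x₀−b)) ) ∈ (0, π/2). That is, I₀ = α·F(ψ₀, p). -/
open MeasureTheory Set in
/-- Change of variables for a substitution that is increasing on `[a, b]`, with no integrability or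
continuity assumption on the integrand. -/
theorem intervalIntegral_deriv_mul_comp_of_deriv_nonneg {f f' g : ℝ → ℝ} {a b : ℝ} (hab : a ≤ b)
    (hfab : f a ≤ f b) (hf : ContinuousOn f (Icc a b))
    (hff' : ∀ t ∈ Ioo a b, HasDerivAt f (f' t) t) (hf' : ∀ t ∈ Ioo a b, 0 ≤ f' t) :
    ∫ u in f a..f b, g u = ∫ t in a..b, f' t * g (f t) := by
  rw [intervalIntegral.integral_of_le hab, intervalIntegral.integral_of_le hfab,
    ← integral_Icc_eq_integral_Ioc, ← integral_Icc_eq_integral_Ioc,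
    ← integral_Icc_deriv_smul_of_deriv_nonneg hf hff' hf' hab]
  simp only [smul_eq_mul]

theorem sq_mul_mul_rpow_neg_half {A B C : ℝ} (hA : 0 ≤ A) (hB : 0 ≤ B) (hC : 0 ≤ C) :
    (A ^ 2 * (B * C)) ^ (-(1 : ℝ) / 2) = A⁻¹ * ((Real.sqrt B)⁻¹ * C ^ (-(1 : ℝ) / 2)) := by
  rw [Real.mul_rpow (sq_nonneg A) (mul_nonneg hB hC), Real.mul_rpow hB hC, Real.sqrt_eq_rpow,
    ← Real.rpow_neg hB, ← Real.rpow_natCast A 2, ← Real.rpow_mul hA, ← Real.rpow_neg_one A]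
  norm_num

/-- The substitution `r = (c x - b d sin² ψ) / (c - d sin² ψ)`, the inverse of
`sin² ψ = (c / d) (r - x) / (r - b)`. -/
theorem hasDerivAt_moebius_sin_sq (b c d x ψ : ℝ) (h : c - d * Real.sin ψ ^ 2 ≠ 0) :
    HasDerivAt (fun t => (c * x - b * d * Real.sin t ^ 2) / (c - d * Real.sin t ^ 2))
      (2 * (d * c * (x - b) * Real.sin ψ * Real.cos ψ / (c - d * Real.sin ψ ^ 2) ^ 2)) ψ := by
  have hs := (Real.hasDerivAt_sin ψ).pow 2
  refine (((hs.const_mul (b * d)).const_sub (c * x)).div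
    ((hs.const_mul d).const_sub c) h).congr_deriv ?_
  simp only [Pi.pow_apply]
  field_simp
  push_cast
  ring

/-- The quartic `r (r - x) (r - b) (r + x + b)` after the substitution
`r = (c x - b d s²) / (c - d s²)` with `c = x + 2b`, `d = 2x + b`. -/
theorem quartic_moebius (b x s k : ℝ) (hx : x ≠ 0) (hc : x + 2 * b ≠ 0) (hk : k ^ 2 = 1 - s ^ 2)
    (hD : (x + 2 * b) - (2 * x + b) * s ^ 2 ≠ 0) :
    let D := (x + 2 * b) - (2 * x + b) * s ^ 2
    let r := ((x + 2 * b) * x - b * (2 * x + b) * s ^ 2) / D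
    r * (r - x) * (r - b) * (r + x + b) =
      ((2 * x + b) * (x + 2 * b) * (x - b) * s * k / D ^ 2) ^ 2 *
        (x * (x + 2 * b) * (1 - b * (2 * x + b) / (x * (x + 2 * b)) * s ^ 2)) := by
  intro D r
  have hr : r = ((x + 2 * b) * x - b * (2 * x + b) * s ^ 2) / D := rfl
  have h1 : r - x = (2 * x + b) * s ^ 2 * (x - b) / D := by
    rw [hr, eq_div_iff hD, sub_mul, div_mul_cancel₀ _ hD]; ring
  have h2 : r - b = (x + 2 * b) * (x - b) / D := by
    rw [hr, eq_div_iff hD, sub_mul, div_mul_cancel₀ _ hD]; ring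
  have h3 : r + x + b = (x + 2 * b) * (2 * x + b) * k ^ 2 / D := by
    rw [hr, hk, eq_div_iff hD, add_mul, add_mul, div_mul_cancel₀ _ hD]; ring
  have h4 : x * (x + 2 * b) * (1 - b * (2 * x + b) / (x * (x + 2 * b)) * s ^ 2) =
      (x + 2 * b) * x - b * (2 * x + b) * s ^ 2 := by
    field_simp
  rw [h1, h2, h3, h4, hr]
  field_simp


/-- For `0 < b < x < x₀`,
`∫_x^{x₀} (r(r−x)(r−b)(r+x+b))^{−1/2} dr = α F(ψ₀, p)` where
`α = 2/√(x(x+2b))`, `p = b(2x+b)/(x(x+2b)) ∈ (0,1)`,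
`ψ₀ = arcsin √(((x+2b)/(2x+b))((x₀−x)/(x₀−b))) ∈ (0, π/2)`, and
`F(ψ₀,p) = ∫₀^{ψ₀} (1 − p sin²ψ)^{−1/2} dψ`. -/
theorem stmt14 (b x x₀ : ℝ) (hb : 0 < b) (hbx : b < x) (hx : x < x₀) :
    let p : ℝ := b * (2 * x + b) / (x * (x + 2 * b))
    let α : ℝ := 2 / Real.sqrt (x * (x + 2 * b))
    let ψ₀ : ℝ :=
      Real.arcsin (Real.sqrt (((x + 2 * b) / (2 * x + b)) * ((x₀ - x) / (x₀ - b))))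
    0 < p ∧ p < 1 ∧ 0 < ψ₀ ∧ ψ₀ < Real.pi / 2 ∧
    (∫ r in x..x₀, (r * (r - x) * (r - b) * (r + x + b)) ^ (-(1 : ℝ) / 2)) =
      α * ∫ ψ in (0 : ℝ)..ψ₀, (1 - p * Real.sin ψ ^ 2) ^ (-(1 : ℝ) / 2) := by
  intro p α ψ₀
  have hx0 : 0 < x := hb.trans hbx
  have hc : 0 < x + 2 * b := by linarith
  have hd : 0 < 2 * x + b := by linarith
  have hxc : 0 < x * (x + 2 * b) := mul_pos hx0 hc
  have hxb : 0 < x₀ - b := by linarith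
  have hp0 : 0 < p := by positivity
  have hp1 : p < 1 := by
    rw [div_lt_one hxc]
    nlinarith [mul_pos (sub_pos.2 hbx) (add_pos hx0 hb)]
  set q : ℝ := ((x + 2 * b) / (2 * x + b)) * ((x₀ - x) / (x₀ - b)) with hq
  have hq0 : 0 < q := mul_pos (div_pos hc hd) (div_pos (sub_pos.2 hx) hxb)
  have hdq : (2 * x + b) * q = (x + 2 * b) * ((x₀ - x) / (x₀ - b)) := by
    rw [hq]; field_simp
  have hfrac : (x₀ - x) / (x₀ - b) < 1 := by
    rw [div_lt_one hxb]; linarith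
  have hdqc : (2 * x + b) * q < x + 2 * b := by
    rw [hdq]; nlinarith
  have hq1 : q < 1 := by nlinarith
  have hψ0 : 0 < ψ₀ := Real.arcsin_pos.2 (Real.sqrt_pos.2 hq0)
  have hψ1 : ψ₀ < Real.pi / 2 :=
    Real.arcsin_lt_pi_div_two.2 ((Real.sqrt_lt' one_pos).2 (by simpa using hq1))
  have hsinψ : Real.sin ψ₀ ^ 2 = q := by
    rw [Real.sin_arcsin (by linarith [Real.sqrt_nonneg q])
      (Real.sqrt_le_one.2 hq1.le), Real.sq_sqrt hq0.le]
  refine ⟨hp0, hp1, hψ0, hψ1, ?_⟩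
  have hD : ∀ t ∈ Set.Icc 0 ψ₀, 0 < (x + 2 * b) - (2 * x + b) * Real.sin t ^ 2 := by
    intro t ht
    have h0 : 0 ≤ Real.sin t :=
      Real.sin_nonneg_of_nonneg_of_le_pi ht.1 (by linarith [ht.2, Real.pi_pos])
    have h1 : Real.sin t ≤ Real.sin ψ₀ :=
      Real.sin_le_sin_of_le_of_le_pi_div_two (by linarith [ht.1, Real.pi_pos]) hψ1.le ht.2
    have h2 : Real.sin t ^ 2 ≤ q := hsinψ ▸ pow_le_pow_left₀ h0 h1 2
    nlinarith
  set f : ℝ → ℝ := fun t => ((x + 2 * b) * x - b * (2 * x + b) * Real.sin t ^ 2) /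
    ((x + 2 * b) - (2 * x + b) * Real.sin t ^ 2) with hf
  have hf0 : f 0 = x := by
    simp [hf, hc.ne']
  have hf1 : f ψ₀ = x₀ := by
    have h := (hD ψ₀ ⟨hψ0.le, le_rfl⟩).ne'
    simp only [hf]
    rw [div_eq_iff h, hsinψ, mul_assoc, hdq]
    field_simp
    ring
  have hderiv : ∀ t ∈ Set.Icc 0 ψ₀, HasDerivAt f _ t :=
    fun t ht => hasDerivAt_moebius_sin_sq b (x + 2 * b) (2 * x + b) x t (hD t ht).ne'
  have hA : ∀ t ∈ Set.Ioo 0 ψ₀, 0 < (2 * x + b) * (x + 2 * b) * (x - b) * Real.sin t * Real.cos t /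
      ((x + 2 * b) - (2 * x + b) * Real.sin t ^ 2) ^ 2 := by
    intro t ht
    have hs : 0 < Real.sin t := Real.sin_pos_of_pos_of_lt_pi ht.1 (by linarith [ht.2, Real.pi_pos])
    have hk : 0 < Real.cos t :=
      Real.cos_pos_of_mem_Ioo ⟨by linarith [ht.1, Real.pi_pos], by linarith [ht.2]⟩
    have := hD t (Set.Ioo_subset_Icc_self ht)
    have := sub_pos.2 hbx
    positivity
  have key := intervalIntegral_deriv_mul_comp_of_deriv_nonneg
    (g := fun r => (r * (r - x) * (r - b) * (r + x + b)) ^ (-(1 : ℝ) / 2)) hψ0.le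
    (by rw [hf0, hf1]; exact hx.le) (fun t ht => (hderiv t ht).continuousAt.continuousWithinAt)
    (fun t ht => hderiv t (Set.Ioo_subset_Icc_self ht))
    (fun t ht => mul_nonneg zero_le_two (hA t ht).le)
  rw [hf0, hf1] at key
  rw [key, ← intervalIntegral.integral_const_mul, intervalIntegral.integral_of_le hψ0.le,
    intervalIntegral.integral_of_le hψ0.le, MeasureTheory.integral_Ioc_eq_integral_Ioo,
    MeasureTheory.integral_Ioc_eq_integral_Ioo]
  refine MeasureTheory.setIntegral_congr_fun measurableSet_Ioo fun t ht => ?_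
  have hps : 0 ≤ 1 - p * Real.sin t ^ 2 := by
    nlinarith [Real.sin_sq_le_one t, sq_nonneg (Real.sin t)]
  have hAt := hA t ht
  have hquart := quartic_moebius b x (Real.sin t) (Real.cos t) hx0.ne' hc.ne'
    (Real.cos_sq' t) (hD t (Set.Ioo_subset_Icc_self ht)).ne'
  simp only [hf]
  simp only at hquart
  rw [hquart, sq_mul_mul_rpow_neg_half hAt.le hxc.le hps, ← mul_assoc, mul_assoc 2,
    mul_inv_cancel₀ hAt.ne', mul_one, ← mul_assoc, ← div_eq_mul_inv]
end

section
/- Let 0 < b < x < x₀ be real numbers. Then ∫_x^{x₀} r · ( r(r−x)(r−b)(r+x+b) )^{−1/2} dr = α·b·F(ψ₀, p) + α·(x−b)·Π(n; ψ₀, p), where α = 2/√(x(x+2b)), p = b(2x+b)/(x(x+2b)), n = (2x+b)/(x+2b), ψ₀ = arcsin √( ((x+2b)/(2x+b)) · ((x₀−x)/(x₀−b)) ), F(ψ₀,p) = ∫₀^{ψ₀} (1 − p sin²ψ)^{−1/2} dψ and Π(n;ψ₀,p) = ∫₀^{ψ₀} (1 − n sin²ψ)^{−1}(1 − p sin²ψ)^{−1/2}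 dψ (a convergent integral since n sin²ψ < 1 on [0, ψ₀]). -/
open Set intervalIntegral

lemma rpow_neg_one_div_two {y : ℝ} (hy : 0 ≤ y) : y ^ (-(1 : ℝ) / 2) = (√y)⁻¹ := by
  rw [neg_div, Real.rpow_neg hy, Real.sqrt_eq_rpow]

lemma hasDerivAt_add_div_one_sub_mul_sin_sq (b c n t : ℝ) (h : 1 - n * Real.sin t ^ 2 ≠ 0) :
    HasDerivAt (fun ψ => b + c / (1 - n * Real.sin ψ ^ 2))
      (2 * c * n * Real.sin t * Real.cos t / (1 - n * Real.sin t ^ 2) ^ 2) t := by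
  have hD := (((Real.hasDerivAt_sin t).pow 2).const_mul n).const_sub 1
  refine (((hasDerivAt_const t c).div hD h).const_add b).congr_deriv ?_
  simp
  ring

/-- The substitution `r = b + (x - b) / (1 - n s ^ 2)`, with `s = sin ψ` and `c = cos ψ`,
turns the quartic into a perfect square times `1 - p s ^ 2`. -/
lemma quartic_subst {b x s c n p : ℝ} (hb : 0 < b) (hbx : b < x) (hsc : s ^ 2 + c ^ 2 = 1)
    (hn : n = (2 * x + b) / (x + 2 * b)) (hp : p = b * (2 * x + b) / (x * (x + 2 * b)))
    (hD : 1 - n * s ^ 2 ≠ 0) {r : ℝ} (hr : r = b + (x - b) / (1 - n * s ^ 2)) :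
    r * (r - x) * (r - b) * (r + x + b) =
      x * (x + 2 * b) * (1 - p * s ^ 2) * ((x - b) * n * s * c / (1 - n * s ^ 2) ^ 2) ^ 2 := by
  have hx : x ≠ 0 := (hb.trans hbx).ne'
  have hxb : x + 2 * b ≠ 0 := by linarith
  have hp' : p = b * n / x := by rw [hp, hn]; field_simp
  have hn' : n * (x + 2 * b) = 2 * x + b := by rw [hn]; field_simp
  set D := 1 - n * s ^ 2 with hDdef
  have h1 : r - b = (x - b) / D := by rw [hr]; ring
  have h2 : r - x = (x - b) * n * s ^ 2 / D := by rw [hr]; field_simp; rw [hDdef]; ring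
  have h3 : r = x * (1 - p * s ^ 2) / D := by rw [hr, hp']; field_simp; rw [hDdef]; ring
  have h4 : r + x + b = n * (x + 2 * b) * c ^ 2 / D := by
    rw [hr]; field_simp
    linear_combination (x + 2 * b) * hDdef - (s ^ 2 + c ^ 2) * hn'
      - (2 * x + b) * hsc
  rw [h1, h2, h4, h3]
  field_simp

/-- For `0 < b < x < x₀`,
`∫_x^{x₀} r (r(r−x)(r−b)(r+x+b))^{−1/2} dr = α b F(ψ₀,p) + α(x−b) Π(n;ψ₀,p)` where
`α = 2/√(x(x+2b))`, `p = b(2x+b)/(x(x+2b))`, `n = (2x+b)/(x+2b)`,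
`ψ₀ = arcsin √(((x+2b)/(2x+b))((x₀−x)/(x₀−b)))`,
`F(ψ₀,p) = ∫₀^{ψ₀} (1 − p sin²ψ)^{−1/2} dψ` and
`Π(n;ψ₀,p) = ∫₀^{ψ₀} (1 − n sin²ψ)^{−1}(1 − p sin²ψ)^{−1/2} dψ`. -/
theorem stmt15 (b x x₀ : ℝ) (hb : 0 < b) (hbx : b < x) (hx : x < x₀) :
    let p : ℝ := b * (2 * x + b) / (x * (x + 2 * b))
    let n : ℝ := (2 * x + b) / (x + 2 * b)
    let α : ℝ := 2 / Real.sqrt (x * (x + 2 * b))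
    let ψ₀ : ℝ :=
      Real.arcsin (Real.sqrt (((x + 2 * b) / (2 * x + b)) * ((x₀ - x) / (x₀ - b))))
    (∫ r in x..x₀, r * (r * (r - x) * (r - b) * (r + x + b)) ^ (-(1 : ℝ) / 2)) =
      α * b * (∫ ψ in (0 : ℝ)..ψ₀, (1 - p * Real.sin ψ ^ 2) ^ (-(1 : ℝ) / 2)) +
        α * (x - b) *
          ∫ ψ in (0 : ℝ)..ψ₀,
            (1 - n * Real.sin ψ ^ 2)⁻¹ * (1 - p * Real.sin ψ ^ 2) ^ (-(1 : ℝ) / 2) := by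
  intro p n α ψ₀
  have hx0 : 0 < x := hb.trans hbx
  have hn0 : 0 < n := by positivity
  have hu : 0 < (x₀ - x) / (x₀ - b) := div_pos (by linarith) (by linarith)
  have hu1 : (x₀ - x) / (x₀ - b) < 1 := (div_lt_one (by linarith)).2 (by linarith)
  have hn1 : 1 ≤ n := (one_le_div (by positivity)).2 (by linarith)
  have hpn : p ≤ n := by
    have : p = n * (b / x) := by simp only [p, n]; field_simp
    rw [this]
    exact mul_le_of_le_one_right hn0.le ((div_le_one hx0).2 hbx.le)
  set w := ((x + 2 * b) / (2 * x + b)) * ((x₀ - x) / (x₀ - b)) with hw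
  have hw0 : 0 < w := by positivity
  have hnw : n * w = (x₀ - x) / (x₀ - b) := by
    simp only [n, hw]; field_simp
  have hw1 : w < 1 := lt_of_le_of_lt (le_mul_of_one_le_left hw0.le hn1) (hnw ▸ hu1)
  have hψ0 : 0 < ψ₀ := Real.arcsin_pos.2 (Real.sqrt_pos.2 hw0)
  have hψ1 : ψ₀ < Real.pi / 2 :=
    Real.arcsin_lt_pi_div_two.2 ((Real.sqrt_lt' one_pos).2 (by simpa using hw1))
  have hsin0 : Real.sin ψ₀ ^ 2 = w := by
    rw [Real.sin_arcsin (by linarith [Real.sqrt_nonneg w])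
      ((Real.sqrt_le_one).2 hw1.le), Real.sq_sqrt hw0.le]
  have hnonneg : ∀ ψ ∈ Icc 0 ψ₀, 0 ≤ Real.sin ψ := fun ψ hψ =>
    Real.sin_nonneg_of_nonneg_of_le_pi hψ.1 (by linarith [hψ.2, Real.pi_pos])
  have hsq : ∀ ψ ∈ Icc 0 ψ₀, Real.sin ψ ^ 2 ≤ w := fun ψ hψ => by
    rw [← hsin0]
    exact pow_le_pow_left₀ (hnonneg ψ hψ) (Real.sin_le_sin_of_le_of_le_pi_div_two
      (by linarith [hψ.1, Real.pi_pos]) hψ1.le hψ.2) 2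
  have hD : ∀ ψ ∈ Icc 0 ψ₀, 0 < 1 - n * Real.sin ψ ^ 2 := fun ψ hψ => by
    have := mul_le_mul_of_nonneg_left (hsq ψ hψ) hn0.le
    linarith
  have hE : ∀ ψ ∈ Icc 0 ψ₀, 0 < 1 - p * Real.sin ψ ^ 2 := fun ψ hψ => by
    have := mul_le_mul_of_nonneg_right hpn (sq_nonneg (Real.sin ψ))
    linarith [hD ψ hψ]
  have hcos : ∀ ψ ∈ Icc 0 ψ₀, 0 < Real.cos ψ := fun ψ hψ =>
    Real.cos_pos_of_mem_Ioo ⟨by linarith [hψ.1, Real.pi_pos], by linarith [hψ.2]⟩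
  have hcE : ContinuousOn (fun ψ => (1 - p * Real.sin ψ ^ 2) ^ (-(1 : ℝ) / 2)) (Icc 0 ψ₀) :=
    ContinuousOn.rpow_const (by fun_prop) fun ψ hψ => Or.inl (hE ψ hψ).ne'
  have hcD : ContinuousOn (fun ψ => (1 - n * Real.sin ψ ^ 2)⁻¹) (Icc 0 ψ₀) :=
    ContinuousOn.inv₀ (by fun_prop) fun ψ hψ => (hD ψ hψ).ne'
  let R : ℝ → ℝ := fun ψ => b + (x - b) / (1 - n * Real.sin ψ ^ 2)
  have hderiv : ∀ ψ ∈ Icc 0 ψ₀, HasDerivAt R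
      (2 * (x - b) * n * Real.sin ψ * Real.cos ψ / (1 - n * Real.sin ψ ^ 2) ^ 2) ψ :=
    fun ψ hψ => hasDerivAt_add_div_one_sub_mul_sin_sq _ _ _ _ (hD ψ hψ).ne'
  have hR0 : R 0 = x := by simp [R]
  have hR1 : R ψ₀ = x₀ := by
    have h1 : x₀ - b ≠ 0 := by linarith
    have h2 : 1 - n * Real.sin ψ₀ ^ 2 = (x - b) / (x₀ - b) := by
      rw [hsin0, hnw]; field_simp; ring
    have h3 : x - b ≠ 0 := by linarith
    simp only [R, h2]
    field_simp
    ring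
  have hsub := integral_comp_mul_deriv_of_deriv_nonneg (a := 0) (b := ψ₀) (f := R)
    (g := fun r => r * (r * (r - x) * (r - b) * (r + x + b)) ^ (-(1 : ℝ) / 2))
    (by
      rw [uIcc_of_le hψ0.le]
      exact fun ψ hψ => (hderiv ψ hψ).continuousAt.continuousWithinAt)
    (by
      rw [min_eq_left hψ0.le, max_eq_right hψ0.le]
      exact fun ψ hψ => hderiv ψ (Ioo_subset_Icc_self hψ))
    (by
      rw [min_eq_left hψ0.le, max_eq_right hψ0.le]
      intro ψ hψ
      have hψ' := Ioo_subset_Icc_self hψ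
      have := hnonneg ψ hψ'
      have := hcos ψ hψ'
      have : 0 < x - b := by linarith
      positivity)
  rw [hR0, hR1] at hsub
  rw [← hsub, ← integral_const_mul, ← integral_const_mul, ← integral_add]
  · refine integral_congr_ae (Filter.Eventually.of_forall fun ψ hψ => ?_)
    rw [uIoc_of_le hψ0.le] at hψ
    have hψ' := Ioc_subset_Icc_self hψ
    have hs : 0 < Real.sin ψ := Real.sin_pos_of_pos_of_lt_pi hψ.1 (by linarith [hψ.2, Real.pi_pos])
    have hc := hcos ψ hψ'
    have hDψ := hD ψ hψ'
    have hEψ := hE ψ hψ'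
    have hxb : 0 < x - b := by linarith
    have hq := quartic_subst hb hbx (Real.sin_sq_add_cos_sq ψ) (n := n) (p := p) rfl rfl
      hDψ.ne' (r := R ψ) rfl
    simp only [Function.comp_apply]
    rw [hq, rpow_neg_one_div_two (by positivity), rpow_neg_one_div_two hEψ.le,
      Real.sqrt_mul (by positivity), Real.sqrt_mul (by positivity),
      Real.sqrt_sq (by positivity)]
    have h1 : √(x * (x + 2 * b)) ≠ 0 := by positivity
    have h2 : √(1 - p * Real.sin ψ ^ 2) ≠ 0 := by positivity
    simp only [R, α]
    generalize √(x * (x + 2 * b)) = A at *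
    generalize √(1 - p * Real.sin ψ ^ 2) = B at *
    generalize 1 - n * Real.sin ψ ^ 2 = D at *
    field_simp
  · exact (hcE.intervalIntegrable_of_Icc hψ0.le).const_mul _
  · exact ((hcD.mul hcE).intervalIntegrable_of_Icc hψ0.le).const_mul _
end

section
/- Let M > 0 and let b, x, x₀ satisfy 2M < b < x < x₀. Then ∫_x^{x₀} (r − 2M)^{−1} · ( r(r−x)(r−b)(r+x+b) )^{−1/2} dr = (α/(b − 2M)) · ( F(ψ₀, p) − ((x−b)/(x−2M)) · Π(m; ψ₀, p) ), where α = 2/√(x(x+2b)), p = b(2x+b)/(x(x+2b)), ψ₀ = arcsin √( ((x+2b)/(2x+b)) · ((x₀−x)/(x₀−b)) ), m = (2x+b)(b−2M)/((x+2b)(x−2M)), F(ψ₀,p) = ∫₀^{ψ₀} (1 − p sin²ψ)^{−1/2} dψ and Π(m;ψ₀,p) = ∫₀^{ψ₀} (1 − m sin²ψ)^{−1}(1 − p sin²ψ)^{−1/2} dψ (convergent since 0 < m < n and n sin²ψ < 1 on [0, ψ₀], n = (2x+b)/(x+2b)). -/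
/-- The inverse square root written as a real power. -/
lemma rpow_neg_one_div_two_of_nonneg {y : ℝ} (hy : 0 ≤ y) :
    y ^ (-(1 : ℝ) / 2) = (Real.sqrt y)⁻¹ := by
  rw [neg_div, Real.rpow_neg hy, Real.sqrt_eq_rpow]

/-- The radial coordinate `r = b + (x - b) / (1 - n s²)`, as a function of `s = sin ψ`, turns
the quartic `r (r - x) (r - b) (r + x + b)` into a perfect square times `1 - p s²`. -/
lemma quartic_substitution {b x s c D : ℝ} (hb : 0 < b) (hbx : b < x) (hsc : s ^ 2 + c ^ 2 = 1)
    (hD : D = 1 - (2 * x + b) / (x + 2 * b) * s ^ 2) (hD0 : D ≠ 0) :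
    (b + (x - b) / D) * (b + (x - b) / D - x) * (b + (x - b) / D - b) *
        (b + (x - b) / D + x + b) =
      ((x - b) * s * c * ((2 * x + b) / (x + 2 * b)) / D ^ 2) ^ 2 * (x * (x + 2 * b)) *
        (1 - b * (2 * x + b) / (x * (x + 2 * b)) * s ^ 2) := by
  have hx : 0 < x := hb.trans hbx
  have h2 : 0 < x + 2 * b := by positivity
  have e1 : b + (x - b) / D = x * (1 - b * (2 * x + b) / (x * (x + 2 * b)) * s ^ 2) / D := by
    field_simp
    rw [hD]
    field_simp
    ring
  have e2 : b + (x - b) / D - x = (x - b) * ((2 * x + b) / (x + 2 * b)) * s ^ 2 / D := by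
    field_simp
    rw [hD]
    field_simp
    ring
  have e3 : b + (x - b) / D + x + b = (2 * x + b) * c ^ 2 / D := by
    rw [eq_sub_of_add_eq' hsc]
    field_simp
    rw [hD]
    field_simp
    ring
  have e4 : b + (x - b) / D - b = (x - b) / D := by ring
  rw [e4, e3, e2, e1]
  field_simp

/-- Partial fraction decomposition of `1 / (r - a)` under `r = b + (x - b) / (1 - n s²)`. -/
lemma inv_sub_substitution {a b x s D : ℝ} (hb : 0 < b) (hab : a < b) (hbx : b < x)
    (hD : D = 1 - (2 * x + b) / (x + 2 * b) * s ^ 2)  (hD0 : 0 < D) :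
    0 < 1 - (2 * x + b) * (b - a) / ((x + 2 * b) * (x - a)) * s ^ 2 ∧
    (b + (x - b) / D - a)⁻¹ = (b - a)⁻¹ * (1 - (x - b) / (x - a) *
      (1 - (2 * x + b) * (b - a) / ((x + 2 * b) * (x - a)) * s ^ 2)⁻¹) := by
  have hx : 0 < x := hb.trans hbx
  have h2 : 0 < x + 2 * b := by positivity
  have h3 : 0 < x - a := by linarith
  have h4 : 0 < b - a := by linarith
  have h5 : 0 < x - b := by linarith
  have e : 1 - (2 * x + b) * (b - a) / ((x + 2 * b) * (x - a)) * s ^ 2 =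
      ((b - a) * D + (x - b)) / (x - a) := by
    rw [hD]
    field_simp
    ring
  have h6 : 0 < (b - a) * D + (x - b) := by positivity
  refine ⟨by rw [e]; positivity, ?_⟩
  have e' : b + (x - b) / D - a = ((b - a) * D + (x - b)) / D := by
    field_simp
    ring
  rw [e, e']
  field_simp
  ring


/-- For `M > 0` and `2M < b < x < x₀`,
`∫_x^{x₀} (r−2M)^{−1} (r(r−x)(r−b)(r+x+b))^{−1/2} dr
  = (α/(b−2M))(F(ψ₀,p) − ((x−b)/(x−2M)) Π(m;ψ₀,p))` where
`α = 2/√(x(x+2b))`, `p = b(2x+b)/(x(x+2b))`,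
`ψ₀ = arcsin √(((x+2b)/(2x+b))((x₀−x)/(x₀−b)))`,
`m = (2x+b)(b−2M)/((x+2b)(x−2M))`,
`F(ψ₀,p) = ∫₀^{ψ₀} (1 − p sin²ψ)^{−1/2} dψ` and
`Π(m;ψ₀,p) = ∫₀^{ψ₀} (1 − m sin²ψ)^{−1}(1 − p sin²ψ)^{−1/2} dψ`. -/
theorem stmt16 (M b x x₀ : ℝ) (hM : 0 < M) (hb : 2 * M < b) (hbx : b < x)
    (hx : x < x₀) :
    let p : ℝ := b * (2 * x + b) / (x * (x + 2 * b))
    let α : ℝ := 2 / Real.sqrt (x * (x + 2 * b))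
    let ψ₀ : ℝ :=
      Real.arcsin (Real.sqrt (((x + 2 * b) / (2 * x + b)) * ((x₀ - x) / (x₀ - b))))
    let m : ℝ := (2 * x + b) * (b - 2 * M) / ((x + 2 * b) * (x - 2 * M))
    (∫ r in x..x₀,
        (r - 2 * M)⁻¹ * (r * (r - x) * (r - b) * (r + x + b)) ^ (-(1 : ℝ) / 2)) =
      (α / (b - 2 * M)) *
        ((∫ ψ in (0 : ℝ)..ψ₀, (1 - p * Real.sin ψ ^ 2) ^ (-(1 : ℝ) / 2)) -
          ((x - b) / (x - 2 * M)) *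
            ∫ ψ in (0 : ℝ)..ψ₀,
              (1 - m * Real.sin ψ ^ 2)⁻¹ * (1 - p * Real.sin ψ ^ 2) ^ (-(1 : ℝ) / 2)) := by
  intro p α ψ₀ m
  have hb0 : 0 < b := by linarith
  have hx0 : 0 < x := by linarith
  have h2 : 0 < x + 2 * b := by positivity
  have hxb : 0 < x - b := by linarith
  have hx₀b : 0 < x₀ - b := by linarith
  have hbM : 0 < b - 2 * M := by linarith
  set n : ℝ := (2 * x + b) / (x + 2 * b) with hn
  have hn0 : 0 < n := by positivity
  set y : ℝ := ((x + 2 * b) / (2 * x + b)) * ((x₀ - x) / (x₀ - b)) with hy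
  have hy0 : 0 < y := mul_pos (by positivity) (div_pos (by linarith) hx₀b)
  have hny : 1 - n * y = (x - b) / (x₀ - b) := by
    rw [hn, hy]
    field_simp
    ring
  have hy1 : y < 1 := by
    rw [hy, div_mul_div_comm, div_lt_one (by positivity)]
    apply mul_lt_mul'' <;> linarith
  have hsqrt : Real.sqrt y < 1 := by rwa [Real.sqrt_lt' one_pos, one_pow]
  have hψ0 : 0 < ψ₀ := Real.arcsin_pos.2 (Real.sqrt_pos.2 hy0)
  have hψ1 : ψ₀ < Real.pi / 2 := Real.arcsin_lt_pi_div_two.2 hsqrt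
  have hsinψ : Real.sin ψ₀ = Real.sqrt y :=
    Real.sin_arcsin (by linarith [Real.sqrt_nonneg y]) hsqrt.le
  have hD : ∀ ψ ∈ Set.uIcc 0 ψ₀, 0 < 1 - n * Real.sin ψ ^ 2 := by
    intro ψ hψ
    rw [Set.uIcc_of_le hψ0.le] at hψ
    have h0 : 0 ≤ Real.sin ψ :=
      Real.sin_nonneg_of_nonneg_of_le_pi hψ.1 (by linarith [hψ.2, Real.pi_pos])
    have h1 : Real.sin ψ ≤ Real.sqrt y := hsinψ ▸
      Real.sin_le_sin_of_le_of_le_pi_div_two (by linarith [hψ.1, Real.pi_pos]) hψ1.le hψ.2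
    have h3 : Real.sin ψ ^ 2 ≤ y := (Real.le_sqrt h0 hy0.le).1 h1
    have h4 : 0 < 1 - n * y := hny ▸ div_pos hxb hx₀b
    linarith [mul_le_mul_of_nonneg_left h3 hn0.le]
  have hm : ∀ ψ ∈ Set.uIcc 0 ψ₀, 0 < 1 - m * Real.sin ψ ^ 2 := fun ψ hψ =>
    (inv_sub_substitution hb0 hb hbx rfl (hD ψ hψ)).1
  have hp : ∀ ψ ∈ Set.uIcc 0 ψ₀, 0 < 1 - p * Real.sin ψ ^ 2 := fun ψ hψ => by
    simpa [p, mul_comm, mul_left_comm] using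
      (inv_sub_substitution hb0 hb0 hbx rfl (hD ψ hψ)).1
  set f : ℝ → ℝ := fun ψ => b + (x - b) / (1 - n * Real.sin ψ ^ 2) with hf
  set f' : ℝ → ℝ := fun ψ =>
    (x - b) * (2 * n * Real.sin ψ * Real.cos ψ) / (1 - n * Real.sin ψ ^ 2) ^ 2 with hf'
  have hderiv : ∀ ψ ∈ Set.uIcc 0 ψ₀, HasDerivAt f (f' ψ) ψ := by
    intro ψ hψ
    have h1 := ((((Real.hasDerivAt_sin ψ).pow 2).const_mul n).const_sub 1)
    have h3 : HasDerivAt f _ ψ := ((hasDerivAt_const ψ (x - b)).div h1 (hD ψ hψ).ne').const_add b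
    refine h3.congr_deriv ?_
    simp [hf']
    ring
  have hf0 : f 0 = x := by simp [hf]
  have hfψ : f ψ₀ = x₀ := by
    simp only [hf, hsinψ, Real.sq_sqrt hy0.le, hny]
    field_simp
    ring
  have hsub := intervalIntegral.integral_comp_mul_deriv_of_deriv_nonneg
    (a := 0) (b := ψ₀) (f := f) (f' := f')
    (g := fun r => (r - 2 * M)⁻¹ * (r * (r - x) * (r - b) * (r + x + b)) ^ (-(1 : ℝ) / 2))
    (fun ψ hψ => (hderiv ψ hψ).continuousAt.continuousWithinAt)
    (fun ψ hψ => hderiv ψ (Set.Ioo_subset_Icc_self hψ))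
    (fun ψ hψ => by
      rw [min_eq_left hψ0.le, max_eq_right hψ0.le] at hψ
      have hs : 0 < Real.sin ψ :=
        Real.sin_pos_of_pos_of_lt_pi hψ.1 (by linarith [hψ.2, Real.pi_pos])
      have hc : 0 < Real.cos ψ :=
        Real.cos_pos_of_mem_Ioo ⟨by linarith [hψ.1, Real.pi_pos], by linarith [hψ.2]⟩
      positivity)
  rw [hf0, hfψ] at hsub
  have hcontF : ContinuousOn (fun ψ => (1 - p * Real.sin ψ ^ 2) ^ (-(1 : ℝ) / 2))
      (Set.uIcc 0 ψ₀) :=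
    ContinuousOn.rpow_const (by fun_prop) fun ψ hψ => Or.inl (hp ψ hψ).ne'
  have hcontm : ContinuousOn (fun ψ => (1 - m * Real.sin ψ ^ 2)⁻¹) (Set.uIcc 0 ψ₀) :=
    ContinuousOn.inv₀ (by fun_prop) fun ψ hψ => (hm ψ hψ).ne'
  rw [← hsub, ← intervalIntegral.integral_const_mul, ← intervalIntegral.integral_sub
    hcontF.intervalIntegrable ((hcontm.fun_mul hcontF).intervalIntegrable.const_mul _),
    ← intervalIntegral.integral_const_mul]
  apply intervalIntegral.integral_congr_Ioo_of_le hψ0.le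
  intro ψ hψ
  have hψ' : ψ ∈ Set.uIcc 0 ψ₀ := by
    rw [Set.uIcc_of_le hψ0.le]; exact Set.Ioo_subset_Icc_self hψ
  have hs : 0 < Real.sin ψ :=
    Real.sin_pos_of_pos_of_lt_pi hψ.1 (by linarith [hψ.2, Real.pi_pos])
  have hc : 0 < Real.cos ψ :=
    Real.cos_pos_of_mem_Ioo ⟨by linarith [hψ.1, Real.pi_pos], by linarith [hψ.2]⟩
  have hDψ := hD ψ hψ'
  have hpψ := hp ψ hψ'
  have hw := Real.sqrt_pos.2 hpψ
  have hA : 0 < Real.sqrt (x * (x + 2 * b)) := Real.sqrt_pos.2 (by positivity)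
  have hP := quartic_substitution (D := 1 - n * Real.sin ψ ^ 2) hb0 hbx (Real.sin_sq_add_cos_sq ψ) rfl hDψ.ne'
  simp only [Function.comp_apply, hf, hf']
  change 0 < 1 - b * (2 * x + b) / (x * (x + 2 * b)) * Real.sin ψ ^ 2 at hpψ
  rw [hP, (inv_sub_substitution hb0 hb hbx rfl hDψ).2, rpow_neg_one_div_two_of_nonneg hpψ.le,
    rpow_neg_one_div_two_of_nonneg (by positivity), Real.sqrt_mul (by positivity),
    Real.sqrt_mul (by positivity), Real.sqrt_sq (by positivity)]
  simp only [α, p, m, ← hn] at hw ⊢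
  generalize Real.sqrt (1 - b * (2 * x + b) / (x * (x + 2 * b)) * Real.sin ψ ^ 2) = w at hw ⊢
  generalize (1 - (2 * x + b) * (b - 2 * M) / ((x + 2 * b) * (x - 2 * M)) *
    Real.sin ψ ^ 2)⁻¹ = u
  generalize 1 - n * Real.sin ψ ^ 2 = D at hDψ ⊢
  field_simp
end

section
/- Let M > 0, r > 2M, θ ∈ (0, π), and let s be a real number. Define f(r) = 1 − 2M/r, A^t(r) = −2s(r − 3M)/(r² f(r)), A^r(r) = 2s(r − M)/r², the divergence D(r) = (1/r²) · d/dr ( r² · A^r(r) ), the (complex-)squared norm Q(r, θ) = −f(r)·A^t(r)² + A^r(r)²/f(r) − r² sin²θ · ( (2s/r²) · (cos θ/sin²θ) )² (the last term being g_{φφ}(A^φ)² for the purely imaginary component A^φ = (2s/r²) i cot θ csc θ), and B(r, θ) = (s/r²)(1 − s cot²θ). Then D(r) = 2s/r² and −(1/4)·D(r) − (1/8)·Q(r, θ) + (1/2)·B(r, θ) = −2Ms²/r³. In particular, the coincidence limit of the Hadamard tail coefficient, [ₛV] = −(1/4)∇_μA^μ − (1/8)A_μA^μ + (1/2)B + R/12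 with R = 0, equals −2Ms²/r³, independently of θ. -/
/-- The `t`-`r` part of `A_μ A^μ` for the Teukolsky operator on Schwarzschild. -/
lemma teukolsky_radial_normSq {M r : ℝ} (s : ℝ) (hr : r ≠ 0) (hrM : r - 2 * M ≠ 0) :
    -(1 - 2 * M / r) * (-2 * s * (r - 3 * M) / (r ^ 2 * (1 - 2 * M / r))) ^ 2 +
      (2 * s * (r - M) / r ^ 2) ^ 2 / (1 - 2 * M / r) = 16 * M * s ^ 2 / r ^ 3 := by
  have hf : 1 - 2 * M / r = (r - 2 * M) / r := by field_simp
  rw [hf]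
  field_simp
  ring

/-- The divergence of `A^μ` for the Teukolsky operator on Schwarzschild. -/
lemma teukolsky_divergence (M s : ℝ) {r : ℝ} (hr : r ≠ 0) :
    1 / r ^ 2 * deriv (fun ρ : ℝ => ρ ^ 2 * (2 * s * (ρ - M) / ρ ^ 2)) r = 2 * s / r ^ 2 := by
  have heq : (fun ρ : ℝ => ρ ^ 2 * (2 * s * (ρ - M) / ρ ^ 2)) =ᶠ[nhds r]
      fun ρ => 2 * s * (ρ - M) := by
    filter_upwards [isOpen_ne.mem_nhds hr] with ρ hρ
    exact mul_div_cancel₀ _ (pow_ne_zero 2 hρ)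
  have hd : HasDerivAt (fun ρ : ℝ => 2 * s * (ρ - M)) (2 * s * 1) r :=
    ((hasDerivAt_id r).sub_const M).const_mul (2 * s)
  rw [heq.deriv_eq, hd.deriv]
  ring

/-- On Schwarzschild (mass `M > 0`, `r > 2M`, `θ ∈ (0,π)`), with
`f(r) = 1 − 2M/r`, `Aᵗ(r) = −2s(r−3M)/(r²f(r))`, `Aʳ(r) = 2s(r−M)/r²`, divergence
`D(r) = (1/r²) d/dr(r² Aʳ(r))`, squared norm
`Q = −f(Aᵗ)² + (Aʳ)²/f − r² sin²θ ((2s/r²)(cosθ/sin²θ))²` and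
`B = (s/r²)(1 − s cot²θ)`, one has `D(r) = 2s/r²` and
`−(1/4)D − (1/8)Q + (1/2)B = −2Ms²/r³`: the coincidence limit of the Hadamard tail
coefficient `[ₛV] = −(1/4)∇·A − (1/8)A·A + (1/2)B + R/12` (with `R = 0`) equals
`−2Ms²/r³`, independently of `θ`. -/
theorem stmt19 (M r θ s : ℝ) (hM : 0 < M) (hr : 2 * M < r)
    (hθ0 : 0 < θ) (hθπ : θ < Real.pi) :
    let f : ℝ → ℝ := fun ρ => 1 - 2 * M / ρ
    let At : ℝ → ℝ := fun ρ => -2 * s * (ρ - 3 * M) / (ρ ^ 2 * f ρ)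
    let Ar : ℝ → ℝ := fun ρ => 2 * s * (ρ - M) / ρ ^ 2
    let D : ℝ → ℝ := fun ρ => (1 / ρ ^ 2) * deriv (fun ρ' => ρ' ^ 2 * Ar ρ') ρ
    let Q : ℝ := -(f r) * (At r) ^ 2 + (Ar r) ^ 2 / f r -
      r ^ 2 * Real.sin θ ^ 2 * ((2 * s / r ^ 2) * (Real.cos θ / Real.sin θ ^ 2)) ^ 2
    let B : ℝ := (s / r ^ 2) * (1 - s * (Real.cos θ / Real.sin θ) ^ 2)
    D r = 2 * s / r ^ 2 ∧
    -(1 / 4) * D r - (1 / 8) * Q + (1 / 2) * B = -2 * M * s ^ 2 / r ^ 3 := by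
  intro f At Ar D Q B
  have hr0 : r ≠ 0 := by linarith
  have hrM : r - 2 * M ≠ 0 := by linarith
  have hsin : Real.sin θ ≠ 0 := (Real.sin_pos_of_pos_of_lt_pi hθ0 hθπ).ne'
  have hD : D r = 2 * s / r ^ 2 := teukolsky_divergence M s hr0
  have hQ : -(f r) * (At r) ^ 2 + (Ar r) ^ 2 / f r = 16 * M * s ^ 2 / r ^ 3 :=
    teukolsky_radial_normSq s hr0 hrM
  refine ⟨hD, ?_⟩
  simp only [Q, B]
  rw [hD, hQ]
  field_simp
  ring
end
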